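/- Let G be a finitely presented group containing a subgroup H isomorphic to F₂ × K, where F₂ is the free group of rank 2 and K is a finite group, such that the extension H ≤ G is almost-CEP. Then G is quotient-saturated: for every finite set V, every partial order ≤ on V, and every coloring c : V → {0,1}, there exists an assignment of normal subgroups N_v ⊴ G (v ∈ V) such that v ↦ N_v is injective, u ≤ v if and only if N_u ≤ N_v, and G/N_v is finitely presented if and only if c(v) = 0. -/

import Mathlib

/-- A group is *finitely presented* if it is isomorphic to the quotient of a
finitely generated free group by the normal closure of a finite set of relators. -/
def FinitelyPresented (G : Type*) [Group G] : Prop :=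
  ∃ (n : ℕ) (R : Set (FreeGroup (Fin n))), R.Finite ∧
    Nonempty ((FreeGroup (Fin n) ⧸ Subgroup.normalClosure R) ≃* G)

/-- A subgroup `H ≤ G` is *almost-CEP* if there is a finite subset
`S ⊆ H ∖ {1}` such that for every `R ⊆ H` whose normal closure in `H` is disjoint
from `S`, the normal closure of `R` in `H` equals `H ∩ ⟪R⟫_G`
(expressed as the pullback of the normal closure of `R` in `G` along `H ↪ G`). -/
def AlmostCEP {G : Type*} [Group G] (H : Subgroup G) : Prop :=
  ∃ S : Set H, S.Finite ∧ (1 : H) ∉ S ∧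
    ∀ R : Set H, (Subgroup.normalClosure R : Set H) ∩ S = ∅ →
      Subgroup.normalClosure R =
        (Subgroup.normalClosure (Subtype.val '' R)).comap H.subtype

/-- A group `G` is *quotient-saturated* if every finite partial order equipped with a
`{0,1}`-coloring is realizable in `G` by normal subgroups. -/
def QuotientSaturated (G : Type*) [Group G] : Prop :=
  ∀ (V : Type) [Fintype V] [PartialOrder V] (c : V → Fin 2),
    ∃ N : V → Subgroup G,
      Function.Injective N ∧
      (∀ u v : V, u ≤ v ↔ N u ≤ N v) ∧
      (∀ v : V, ∃ h : (N v).Normal,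
        ((letI := h; FinitelyPresented (G ⧸ N v)) ↔ c v = 0))

open Subgroup
open scoped commutatorElement

/-- Every element of a normal closure lies in the normal closure of a finite subset. -/
theorem exists_finite_mem_normalClosure {G : Type*} [Group G] {A : Set G} {g : G}
    (hg : g ∈ normalClosure A) : ∃ B ⊆ A, B.Finite ∧ g ∈ normalClosure B := by
  induction hg using closure_induction with
  | mem x hx =>
    obtain ⟨a, ha, hax⟩ := Group.mem_conjugatesOfSet_iff.1 hx
    exact ⟨{a}, Set.singleton_subset_iff.2 ha, Set.finite_singleton a,
      conjugatesOfSet_subset_normalClosure (Group.mem_conjugatesOfSet_iff.2 ⟨a, rfl, hax⟩)⟩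
  | one => exact ⟨∅, Set.empty_subset A, Set.finite_empty, one_mem _⟩
  | mul x y _ _ hx hy =>
    obtain ⟨B, hB, hBf, hxB⟩ := hx
    obtain ⟨C, hC, hCf, hyC⟩ := hy
    exact ⟨B ∪ C, Set.union_subset hB hC, hBf.union hCf,
      mul_mem (normalClosure_mono Set.subset_union_left hxB)
        (normalClosure_mono Set.subset_union_right hyC)⟩
  | inv x _ hx =>
    obtain ⟨B, hB, hBf, hxB⟩ := hx
    exact ⟨B, hB, hBf, inv_mem hxB⟩

/-- If a normal closure is finitely normally generated, finitely many of the given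
generators suffice. -/
theorem exists_finite_subset_normalClosure_eq {G : Type*} [Group G] {A : Set G}
    (h : (normalClosure A).IsFinitelyNormallyGenerated) :
    ∃ B ⊆ A, B.Finite ∧ normalClosure B = normalClosure A := by
  obtain ⟨R, hR, hRA⟩ := h
  have hmem : ∀ r ∈ R, ∃ B ⊆ A, B.Finite ∧ r ∈ normalClosure B := fun r hr ↦
    exists_finite_mem_normalClosure (hRA ▸ subset_normalClosure hr)
  choose! B hBA hBf hrB using hmem
  have hsub : (⋃ r ∈ R, B r) ⊆ A := Set.iUnion₂_subset hBA
  refine ⟨⋃ r ∈ R, B r, hsub, hR.biUnion hBf, le_antisymm (normalClosure_mono hsub) ?_⟩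
  rw [← hRA]
  exact normalClosure_le_normal fun r hr ↦
    normalClosure_mono (Set.subset_biUnion_of_mem hr) (hrB r hr)

theorem FinitelyPresented.isFinitelyPresented {G : Type*} [Group G] (h : FinitelyPresented G) :
    Group.IsFinitelyPresented G := by
  obtain ⟨n, R, hR, ⟨e⟩⟩ := h
  have := Group.IsFinitelyPresented.quotient (normalClosure R) ⟨R, hR, rfl⟩
  exact Group.IsFinitelyPresented.equiv e

theorem finitelyPresented_iff {G : Type*} [Group G] :
    FinitelyPresented G ↔ Group.IsFinitelyPresented G := by
  refine ⟨FinitelyPresented.isFinitelyPresented, fun h ↦ ?_⟩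
  obtain ⟨n, R, hR, ⟨e⟩⟩ := Group.IsFinitelyPresented.exists_mulEquiv_presentedGroup (G := G)
  exact ⟨n, R, hR, ⟨e.symm⟩⟩

/-- The kernel of a surjection from a finitely generated group onto a finitely presented group
is finitely normally generated. -/
theorem isFinitelyNormallyGenerated_ker {G Q : Type*} [Group G] [Group Q] [hG : Group.FG G]
    [hQ : Group.IsFinitelyPresented Q] (f : G →* Q) (hf : Function.Surjective f) :
    f.ker.IsFinitelyNormallyGenerated := by
  obtain ⟨n, φ, hφ, R, hR, hRφ⟩ := hQ.out
  obtain ⟨A, hA⟩ := hG.out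
  choose s hs using fun i ↦ hf (φ (FreeGroup.of i))
  let σ : FreeGroup (Fin n) →* G := FreeGroup.lift s
  have hσ : ∀ w, f (σ w) = φ w := fun w ↦ DFunLike.congr_fun
    (FreeGroup.ext_hom (f.comp σ) φ fun i ↦ by simp [σ, hs]) w
  choose r hr using fun g ↦ hφ (f g)
  let T : Set G := σ '' R ∪ (fun g ↦ g⁻¹ * σ (r g)) '' (A : Set G)
  have hTker : normalClosure T ≤ f.ker := by
    refine normalClosure_le_normal ?_
    rintro _ (⟨w, hw, rfl⟩ | ⟨g, -, rfl⟩)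
    · have hwφ : w ∈ φ.ker := hRφ ▸ subset_normalClosure hw
      simpa [hσ] using hwφ
    · simp [hσ, hr]
  refine ⟨T, (hR.image _).union (A.finite_toSet.image _), le_antisymm hTker ?_⟩
  have hrange : ((QuotientGroup.mk' (normalClosure T)).comp σ).range = ⊤ := by
    rw [← MonoidHom.range_eq_top.2 (QuotientGroup.mk'_surjective (normalClosure T)),
      MonoidHom.range_eq_map (QuotientGroup.mk' _), ← hA]
    refine le_antisymm ?_ ?_
    · rw [hA, ← MonoidHom.range_eq_map, MonoidHom.range_comp]
      exact Subgroup.map_le_range _ _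
    · rw [MonoidHom.map_closure, closure_le]
      rintro _ ⟨g, hg, rfl⟩
      have hT : g⁻¹ * σ (r g) ∈ normalClosure T := subset_normalClosure (Or.inr ⟨g, hg, rfl⟩)
      exact ⟨r g, (QuotientGroup.eq.2 hT).symm⟩
  intro g hg
  obtain ⟨w, hw⟩ : (g : G ⧸ normalClosure T) ∈
    ((QuotientGroup.mk' (normalClosure T)).comp σ).range := hrange ▸ mem_top _
  have hgw : (σ w)⁻¹ * g ∈ normalClosure T := QuotientGroup.eq.1 hw
  have hwφ : w ∈ normalClosure R := by
    have h1 : (σ w)⁻¹ * g ∈ f.ker := hTker hgw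
    rw [hRφ, MonoidHom.mem_ker, ← hσ]
    simpa [MonoidHom.mem_ker.1 hg] using h1
  have hσw : σ w ∈ normalClosure T :=
    normalClosure_mono Set.subset_union_left
      (map_normalClosure_le R σ (mem_map_of_mem σ hwφ))
  simpa using mul_mem hσw hgw

/-- A quotient of a finitely presented group is finitely presented if and only if the kernel is
finitely normally generated. -/
theorem finitelyPresented_quotient_iff {G : Type*} [Group G] (hG : FinitelyPresented G)
    (N : Subgroup G) [N.Normal] :
    FinitelyPresented (G ⧸ N) ↔ N.IsFinitelyNormallyGenerated := by
  have := hG.isFinitelyPresented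
  rw [finitelyPresented_iff]
  refine ⟨fun h ↦ ?_, fun h ↦ Group.IsFinitelyPresented.quotient N h⟩
  obtain ⟨n, φ, hφ, -⟩ := this.out
  have : Group.FG G := Group.fg_of_surjective hφ
  simpa using isFinitelyNormallyGenerated_ker (QuotientGroup.mk' N)
    (QuotientGroup.mk'_surjective N)

/-- Free groups are residually finite. -/
instance FreeGroup.residuallyFinite (α : Type*) : Group.ResiduallyFinite (FreeGroup α) := by
  classical
  refine Group.residuallyFinite_of_forall_exists_finite_monoidHom fun g hg ↦ ?_
  let B : Set (FreeGroup α) := FreeGroup.mk '' {l | l ∈ g.toWord.tails}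
  have hB : Finite B := Set.Finite.image _ (List.finite_toSet _)
  have hσ : ∀ x : α, ∃ σ : Equiv.Perm B, ∀ b : B, ∀ h : FreeGroup.of x * b.1 ∈ B,
      σ b = ⟨FreeGroup.of x * b.1, h⟩ := by
    intro x
    obtain ⟨σ, hσ⟩ := Equiv.Perm.exists_extending_pair
      (fun b : {b : B // FreeGroup.of x * b.1 ∈ B} ↦ b.1)
      (fun b ↦ (⟨FreeGroup.of x * b.1.1, b.2⟩ : B)) Subtype.val_injective
      (fun b c h ↦ Subtype.ext (Subtype.ext (by simpa using h)))
    exact ⟨σ, fun b h ↦ hσ ⟨b, h⟩⟩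
  choose σ hσ using hσ
  have h1 : (1 : FreeGroup α) ∈ B := ⟨[], by simp, rfl⟩
  have key : ∀ l, l <:+ g.toWord →
      (FreeGroup.lift σ (FreeGroup.mk l) ⟨1, h1⟩ : B).1 = FreeGroup.mk l := by
    intro l
    induction l with
    | nil => intro _; rfl
    | cons a l ih =>
      intro hl
      have hl' : l <:+ g.toWord := (List.suffix_cons a l).trans hl
      have hmem : FreeGroup.mk l ∈ B := ⟨l, by simpa using hl', rfl⟩
      have hmem' : FreeGroup.mk (a :: l) ∈ B := ⟨a :: l, by simpa using hl, rfl⟩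
      have hb : FreeGroup.lift σ (FreeGroup.mk l) ⟨1, h1⟩ = ⟨FreeGroup.mk l, hmem⟩ :=
        Subtype.ext (ih hl')
      have hcons : FreeGroup.mk (a :: l) = FreeGroup.mk [a] * FreeGroup.mk l := by simp
      rw [hcons] at hmem' ⊢
      rw [_root_.map_mul, Equiv.Perm.mul_apply, hb]
      obtain ⟨x, _ | _⟩ := a
      · have hx : FreeGroup.mk [(x, false)] = (FreeGroup.of x)⁻¹ := rfl
        rw [hx] at hmem' ⊢
        rw [_root_.map_inv, FreeGroup.lift_apply_of]
        suffices (σ x)⁻¹ ⟨FreeGroup.mk l, hmem⟩ =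
          ⟨(FreeGroup.of x)⁻¹ * FreeGroup.mk l, hmem'⟩ from congrArg Subtype.val this
        rw [Equiv.Perm.inv_eq_iff_eq, hσ x _ (by simpa using hmem)]
        simp
      · have hx : FreeGroup.mk [(x, true)] = FreeGroup.of x := rfl
        rw [hx] at hmem' ⊢
        rw [FreeGroup.lift_apply_of, hσ x _ hmem']
  refine ⟨Equiv.Perm B, inferInstance, inferInstance, FreeGroup.lift σ, fun h ↦ hg ?_⟩
  have := key g.toWord List.suffix_rfl
  rw [FreeGroup.mk_toWord, h] at this
  exact this.symm

/-- A finite set of nontrivial elements of a residually finite group is avoided by a normal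
subgroup of finite index. -/
theorem Group.ResiduallyFinite.exists_normal_finiteIndex_disjoint {G : Type*} [Group G]
    [Group.ResiduallyFinite G] {T : Set G} (hT : T.Finite) (h1 : (1 : G) ∉ T) :
    ∃ D : Subgroup G, D.Normal ∧ D.FiniteIndex ∧ Disjoint (D : Set G) T := by
  have := hT.to_subtype
  choose D hD using fun t : T ↦ Group.exists_finiteIndexNormalSubgroup_notMem t.1
    (fun h ↦ h1 (h ▸ t.2))
  refine ⟨⨅ t, (D t).toSubgroup, normal_iInf_normal fun t ↦ (D t).isNormal',
    finiteIndex_iInf fun t ↦ (D t).isFiniteIndex', Set.disjoint_left.2 fun g hg hgT ↦ ?_⟩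
  exact hD ⟨g, hgT⟩ (mem_iInf.1 hg ⟨g, hgT⟩)

/-- The permutation of `ℤ × ZMod q × ZMod q` that translates the middle coordinate by `c` in the
fibre over `0` and shears by `c` in the fibre over `k + 1`. -/
def shearPerm (q k : ℕ) (c : ZMod q) : Equiv.Perm (ℤ × ZMod q × ZMod q) where
  toFun z := (z.1, z.2.1 + (if z.1 = 0 then c else 0),
    z.2.2 + (if z.1 = (k + 1 : ℕ) then c * z.2.1 else 0))
  invFun z := (z.1, z.2.1 + (if z.1 = 0 then -c else 0),
    z.2.2 + (if z.1 = (k + 1 : ℕ) then -c * z.2.1 else 0))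
  left_inv z := by
    obtain ⟨n, x, y⟩ := z
    have : ¬ (n = 0 ∧ n = (k + 1 : ℕ)) := by omega
    by_cases h : n = 0 <;> by_cases h' : n = (k + 1 : ℕ) <;> simp_all
  right_inv z := by
    obtain ⟨n, x, y⟩ := z
    have : ¬ (n = 0 ∧ n = (k + 1 : ℕ)) := by omega
    by_cases h : n = 0 <;> by_cases h' : n = (k + 1 : ℕ) <;> simp_all

theorem shearPerm_apply (q k : ℕ) (c : ZMod q) (n : ℤ) (x y : ZMod q) :
    shearPerm q k c (n, x, y) = (n, x + (if n = 0 then c else 0),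
      y + (if n = (k + 1 : ℕ) then c * x else 0)) := rfl

theorem shearPerm_one_pow (q k m : ℕ) : shearPerm q k 1 ^ m = shearPerm q k m := by
  induction m with
  | zero => ext ⟨n, x, y⟩ <;> simp [shearPerm_apply]
  | succ m ih =>
    rw [pow_succ', ih]
    ext ⟨n, x, y⟩ : 1
    have : ¬ (n = 0 ∧ n = (k + 1 : ℕ)) := by omega
    simp only [Equiv.Perm.mul_apply, shearPerm_apply]
    by_cases h : n = 0 <;> by_cases h' : n = (k + 1 : ℕ) <;> simp_all <;> ring

/-- Translation by `1` in the integer coordinate of `ℤ × ZMod q × ZMod q`. -/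
def shiftPerm (q : ℕ) : Equiv.Perm (ℤ × ZMod q × ZMod q) :=
  Equiv.prodCongr (Equiv.addRight 1) (Equiv.refl _)

theorem shiftPerm_pow_apply (q j : ℕ) (n : ℤ) (v : ZMod q × ZMod q) :
    (shiftPerm q ^ j) (n, v) = (n + j, v) := by
  induction j generalizing n with
  | zero => simp
  | succ j ih =>
    rw [pow_succ, Equiv.Perm.mul_apply]
    simp only [shiftPerm, Equiv.prodCongr_apply, Prod.map, Equiv.coe_addRight,
      Equiv.refl_apply] at ih ⊢
    rw [ih]
    push_cast
    congr 1
    ring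

theorem shiftPerm_conj_shearPerm_apply (q j k : ℕ) (c : ZMod q) (n : ℤ) (x y : ZMod q) :
    (shiftPerm q ^ j * shearPerm q k c * (shiftPerm q ^ j)⁻¹) (n, x, y) =
      (n, x + (if n = j then c else 0), y + (if n = j + (k + 1 : ℕ) then c * x else 0)) := by
  have h : (shiftPerm q ^ j)⁻¹ (n, x, y) = (n - j, x, y) := by
    rw [Equiv.Perm.inv_eq_iff_eq, shiftPerm_pow_apply, sub_add_cancel]
  rw [Equiv.Perm.mul_apply, Equiv.Perm.mul_apply, h, shearPerm_apply, shiftPerm_pow_apply,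
    sub_add_cancel]
  simp only [sub_eq_iff_eq_add', add_zero]

theorem commute_shearPerm_conj {q j k : ℕ} (c : ZMod q) (hjk : j ≠ k) :
    Commute (shearPerm q k c)
      (shiftPerm q ^ (j + 1) * shearPerm q k c * (shiftPerm q ^ (j + 1))⁻¹) := by
  refine Equiv.ext fun ⟨n, x, y⟩ ↦ ?_
  rw [Equiv.Perm.mul_apply (shearPerm q k c), Equiv.Perm.mul_apply _ (shearPerm q k c),
    shiftPerm_conj_shearPerm_apply, shearPerm_apply, shearPerm_apply,
    shiftPerm_conj_shearPerm_apply]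
  have h1 : ¬ (n = 0 ∧ n = (j + 1 : ℕ) + (k + 1 : ℕ)) := by omega
  have h2 : ¬ (n = (j + 1 : ℕ) ∧ n = (k + 1 : ℕ)) := by omega
  simp only [Prod.mk.injEq, true_and]
  refine ⟨by ring, ?_⟩
  split_ifs <;> first | (exfalso; omega) | ring

theorem not_commute_shearPerm_conj {q k : ℕ} {c : ZMod q} (hc : c * c ≠ 0) :
    ¬ Commute (shearPerm q k c)
      (shiftPerm q ^ (k + 1) * shearPerm q k c * (shiftPerm q ^ (k + 1))⁻¹) := by
  intro h
  have h := DFunLike.congr_fun h.eq (((k + 1 : ℕ) : ℤ), 0, 0)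
  rw [Equiv.Perm.mul_apply (shearPerm q k c), Equiv.Perm.mul_apply _ (shearPerm q k c),
    shiftPerm_conj_shearPerm_apply, shearPerm_apply, shearPerm_apply,
    shiftPerm_conj_shearPerm_apply] at h
  have h1 : (k : ℤ) + 1 ≠ 0 := by omega
  exact hc (by simpa [h1] using h)

/-- The representation of the free group of rank two sending the generators to the shear and to
the shift. -/
def shearRep (q k : ℕ) : FreeGroup (Fin 2) →* Equiv.Perm (ℤ × ZMod q × ZMod q) :=
  FreeGroup.lift ![shearPerm q k 1, shiftPerm q]

/-- The commutator of `a ^ m` with its conjugate by `t ^ (j + 1)`, where `a`, `t` are the free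
generators. -/
def conjCommutator (m j : ℕ) : FreeGroup (Fin 2) :=
  ⁅(FreeGroup.of 0 ^ m : FreeGroup (Fin 2)),
    FreeGroup.of 1 ^ (j + 1) * FreeGroup.of 0 ^ m * (FreeGroup.of 1 ^ (j + 1))⁻¹⁆

theorem shearRep_of_zero_pow (q k m : ℕ) :
    shearRep q k (FreeGroup.of 0 ^ m) = shearPerm q k m := by
  simp [shearRep, shearPerm_one_pow]

theorem shearRep_conjCommutator_eq_one_iff (q k m j : ℕ) :
    shearRep q k (conjCommutator m j) = 1 ↔ Commute (shearPerm q k m)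
      (shiftPerm q ^ (j + 1) * shearPerm q k m * (shiftPerm q ^ (j + 1))⁻¹) := by
  rw [← commutatorElement_eq_one_iff_commute, conjCommutator, map_commutatorElement, map_mul,
    map_mul, map_inv, shearRep_of_zero_pow]
  simp [shearRep]

theorem shearRep_of_zero_pow_eq_one {q m : ℕ} (k : ℕ) (h : q ∣ m) :
    shearRep q k (FreeGroup.of 0 ^ m) = 1 := by
  rw [shearRep_of_zero_pow, (ZMod.natCast_eq_zero_iff m q).2 h, ← Nat.cast_zero,
    ← shearPerm_one_pow, pow_zero]

theorem shearRep_conjCommutator_of_ne (q m : ℕ) {j k : ℕ} (hjk : j ≠ k) :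
    shearRep q k (conjCommutator m j) = 1 :=
  (shearRep_conjCommutator_eq_one_iff q k m j).2 (commute_shearPerm_conj _ hjk)

theorem shearRep_conjCommutator_self_ne {q m : ℕ} (hq : q.Prime) (k : ℕ) (h : ¬ q ∣ m) :
    shearRep q k (conjCommutator m k) ≠ 1 := by
  have := Fact.mk hq
  have hm : (m : ZMod q) ≠ 0 := by rwa [Ne, ZMod.natCast_eq_zero_iff]
  exact fun h1 ↦ not_commute_shearPerm_conj (mul_ne_zero hm hm)
    ((shearRep_conjCommutator_eq_one_iff q k m k).1 h1)

theorem conjCommutator_mem {N : Subgroup (FreeGroup (Fin 2))} [N.Normal] {m : ℕ}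
    (h : FreeGroup.of 0 ^ m ∈ N) (j : ℕ) : conjCommutator m j ∈ N := by
  rw [conjCommutator, commutatorElement_def]
  have h' := Subgroup.Normal.conj_mem ‹_› _ h (FreeGroup.of 1 ^ (j + 1))
  exact mul_mem (mul_mem (mul_mem h h') (inv_mem h)) (inv_mem h')

/-- Given finitely many indices and `M > 0`, there are distinct primes `p v` and multiples `m v`
of `M` such that `p u` divides `m v` exactly when `u ≠ v`. -/
theorem exists_primes_dvd_iff_ne (V : Type*) [Finite V] {M : ℕ} (hM : M ≠ 0) :
    ∃ p m : V → ℕ, (∀ v, (p v).Prime) ∧ (∀ v, M ∣ m v) ∧ ∀ u v, p u ∣ m v ↔ u ≠ v := by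
  classical
  have := Fintype.ofFinite V
  let e := Fintype.equivFin V
  let p : V → ℕ := fun v ↦ Nat.nth Nat.Prime (M + e v)
  have hp : ∀ v, (p v).Prime := fun v ↦ Nat.prime_nth_prime _
  have hpM : ∀ v, ¬ p v ∣ M := fun v h ↦ by
    have h1 := Nat.le_of_dvd (Nat.pos_of_ne_zero hM) h
    have h2 : M + e v + 2 ≤ p v := Nat.add_two_le_nth_prime _
    omega
  have hinj : Function.Injective p := fun u v h ↦ by
    have h1 := Nat.nth_injective Nat.infinite_setOfPred_prime h
    exact e.injective (Fin.ext (by omega))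
  refine ⟨p, fun v ↦ M * ∏ u ∈ Finset.univ.erase v, p u, hp, fun v ↦ dvd_mul_right _ _,
    fun u v ↦ ⟨?_, fun h ↦ ?_⟩⟩
  · rintro h rfl
    rcases (hp u).dvd_mul.1 h with h | h
    · exact hpM u h
    · obtain ⟨w, hw, hdvd⟩ := ((hp u).prime.dvd_finsetProd_iff p).1 h
      exact Finset.ne_of_mem_erase hw (hinj ((Nat.prime_dvd_prime_iff_eq (hp u) (hp w)).1 hdvd)).symm
  · exact dvd_mul_of_dvd_right (Finset.dvd_prod_of_mem p (by simpa using h)) _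

/-- The free group of rank two realizes every finite coloured poset by normal subgroups avoiding a
given finite set of nontrivial elements, the colour recording finite normal generation. -/
theorem exists_normal_subgroups_freeGroup {T : Set (FreeGroup (Fin 2))} (hT : T.Finite)
    (h1 : (1 : FreeGroup (Fin 2)) ∉ T) (V : Type*) [Finite V] [PartialOrder V] (c : V → Fin 2) :
    ∃ P : V → Subgroup (FreeGroup (Fin 2)), (∀ v, (P v).Normal) ∧
      (∀ u v, u ≤ v ↔ P u ≤ P v) ∧
      (∀ v, (P v).IsFinitelyNormallyGenerated ↔ c v = 0) ∧
      ∀ v, Disjoint (P v : Set (FreeGroup (Fin 2))) T := by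
  obtain ⟨D, hD, hDf, hDT⟩ := Group.ResiduallyFinite.exists_normal_finiteIndex_disjoint hT h1
  obtain ⟨p, m, hp, hM, hpm⟩ := exists_primes_dvd_iff_ne V hDf.index_ne_zero
  let x : V → FreeGroup (Fin 2) := fun v ↦ FreeGroup.of 0 ^ m v
  let w : V → ℕ → FreeGroup (Fin 2) := fun v ↦ conjCommutator (m v)
  let A : V → Set (FreeGroup (Fin 2)) := fun v ↦
    x '' Set.Iio v ∪ if c v = 0 then {x v} else Set.range (w v)
  have hker : ∀ {u v}, u ≠ v → ∀ k, x v ∈ (shearRep (p u) k).ker := fun h k ↦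
    shearRep_of_zero_pow_eq_one k ((hpm _ _).2 h)
  have hw_ne : ∀ v k, w v k ∉ (shearRep (p v) k).ker := fun v k ↦
    shearRep_conjCommutator_self_ne (hp v) k fun h ↦ (hpm v v).1 h rfl
  have hA_le : ∀ v (N : Subgroup (FreeGroup (Fin 2))) [N.Normal], (∀ u ≤ v, x u ∈ N) →
      normalClosure (A v) ≤ N := by
    intro v N _ hN
    refine normalClosure_le_normal (Set.union_subset ?_ ?_)
    · rintro _ ⟨u, hu, rfl⟩
      exact hN u (le_of_lt hu)
    · split_ifs
      · exact Set.singleton_subset_iff.2 (hN v le_rfl)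
      · rintro _ ⟨k, rfl⟩
        exact conjCommutator_mem (hN v le_rfl) k
  have hw_mem : ∀ v k, w v k ∈ normalClosure (A v) := by
    intro v k
    by_cases hc : c v = 0
    · exact conjCommutator_mem (subset_normalClosure (Or.inr (by simp [hc, x]))) k
    · exact subset_normalClosure (Or.inr (by simp [hc]))
  refine ⟨fun v ↦ normalClosure (A v), fun v ↦ normalClosure_normal, fun u v ↦ ⟨fun h ↦ ?_, ?_⟩,
    fun v ↦ ⟨?_, fun hc ↦ ⟨A v, ?_, rfl⟩⟩, fun v ↦ ?_⟩
  · obtain rfl | h := h.eq_or_lt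
    · exact le_rfl
    · exact hA_le u _ fun u' hu' ↦
        subset_normalClosure (Or.inl (Set.mem_image_of_mem x (hu'.trans_lt h)))
  · intro h
    by_contra huv
    refine hw_ne u 0 (hA_le v (shearRep (p u) 0).ker (fun u' hu' ↦ hker ?_ 0) (h (hw_mem u 0)))
    rintro rfl
    exact huv hu'
  · intro h
    by_contra hc
    obtain ⟨B, hBA, hB, hBeq⟩ := exists_finite_subset_normalClosure_eq h
    have hinj : Function.Injective (w v) := fun j k hjk ↦ by
      by_contra hne
      exact hw_ne v k (hjk ▸ shearRep_conjCommutator_of_ne (p v) (m v) hne)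
    obtain ⟨_, ⟨k, rfl⟩, hk⟩ := (Set.infinite_range_of_injective hinj).exists_notMem_finite hB
    refine hw_ne v k ((normalClosure_le_normal ?_) (hBeq ▸ hw_mem v k))
    intro b hb
    have hbA := hBA hb
    simp only [A, if_neg hc] at hbA
    obtain ⟨u, hu, rfl⟩ | ⟨j, rfl⟩ := hbA
    · exact hker (ne_of_gt hu) k
    · exact shearRep_conjCommutator_of_ne (p v) (m v) fun hjk ↦ hk (hjk ▸ hb)
  · simp only [A, if_pos hc]
    exact (Set.toFinite _).union (Set.finite_singleton _)
  · refine hDT.mono_left (hA_le v D fun u _ ↦ ?_)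
    obtain ⟨d, hd⟩ := hM u
    simp only [x, hd, pow_mul]
    exact pow_mem (D.pow_index_mem _) d

/-- Suppose that taking normal closures in `G` of subsets of `H` does not enlarge normal closures
in `H` that avoid `S`. A normal subgroup of `H` avoiding `S` is then finitely normally generated in
`H` if and only if its normal closure in `G` is finitely normally generated. -/
theorem isFinitelyNormallyGenerated_normalClosure_iff {G : Type*} [Group G] {H : Subgroup G}
    {S : Set H} (hS : ∀ R : Set H, (normalClosure R : Set H) ∩ S = ∅ →
      normalClosure R = (normalClosure (Subtype.val '' R)).comap H.subtype)
    {M : Subgroup H} [M.Normal] (hM : Disjoint (M : Set H) S) :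
    (normalClosure (Subtype.val '' (M : Set H))).IsFinitelyNormallyGenerated ↔
      M.IsFinitelyNormallyGenerated := by
  constructor
  · intro h
    obtain ⟨B, hBM, hB, hBeq⟩ := exists_finite_subset_normalClosure_eq h
    obtain ⟨R, hRM, rfl⟩ := Set.subset_image_iff.1 hBM
    have hRle : normalClosure R ≤ M := normalClosure_le_normal hRM
    have hR := hS R (Set.disjoint_of_subset_left hRle hM).inter_eq
    have hMeq := hS M (by rw [normalClosure_eq_self]; exact hM.inter_eq)
    rw [normalClosure_eq_self] at hMeq
    exact ⟨R, hB.of_finite_image Subtype.val_injective.injOn, by rw [hR, hBeq, ← hMeq]⟩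
  · rintro ⟨R, hR, hRM⟩
    refine ⟨Subtype.val '' R, hR.image _, le_antisymm (normalClosure_mono (Set.image_mono ?_))
      (normalClosure_le_normal ?_)⟩
    · exact hRM ▸ subset_normalClosure
    · rintro _ ⟨h, hh, rfl⟩
      exact map_normalClosure_le R H.subtype (mem_map_of_mem H.subtype (hRM.symm ▸ hh))

/-- The image of a normal subgroup of the first factor is normal in a direct product. -/
theorem Subgroup.Normal.map_inl {F K : Type*} [Group F] [Group K] {P : Subgroup F} (hP : P.Normal) :
    (P.map (MonoidHom.inl F K)).Normal := by
  refine ⟨?_⟩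
  rintro _ ⟨f, hf, rfl⟩ ⟨g, k⟩
  exact ⟨g * f * g⁻¹, hP.conj_mem f hf g, by simp⟩

theorem Subgroup.isFinitelyNormallyGenerated_map_inl_iff {F K : Type*} [Group F] [Group K]
    {P : Subgroup F} (hP : P.Normal) :
    (P.map (MonoidHom.inl F K)).IsFinitelyNormallyGenerated ↔ P.IsFinitelyNormallyGenerated := by
  constructor
  · intro h
    have := h.map (f := MonoidHom.fst F K) Prod.fst_surjective
    rwa [map_map, MonoidHom.fst_comp_inl, map_id] at this
  · rintro ⟨R, hR, rfl⟩
    have := hP.map_inl (K := K)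
    exact ⟨MonoidHom.inl F K '' R, hR.image _, le_antisymm
      (normalClosure_le_normal (Set.image_mono subset_normalClosure)) (map_normalClosure_le R _)⟩

theorem Subgroup.isFinitelyNormallyGenerated_map_equiv_iff {G H : Type*} [Group G] [Group H]
    {P : Subgroup G} (e : G ≃* H) :
    (P.map (e : G →* H)).IsFinitelyNormallyGenerated ↔ P.IsFinitelyNormallyGenerated := by
  refine ⟨fun h ↦ ?_, fun h ↦ h.map e.surjective⟩
  have := h.map (f := (e.symm : H →* G)) e.symm.surjective
  rwa [map_map, MulEquiv.coe_monoidHom_symm_comp_coe_monoidHom, map_id] at this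

/-- If a finitely presented group `G` contains an almost-CEP subgroup isomorphic to
`F₂ × K` with `K` finite, then `G` is quotient-saturated. -/
theorem stmt_18 {G K : Type*} [Group G] [Group K] [Finite K]
    (hfp : FinitelyPresented G) (H : Subgroup G)
    (hiso : Nonempty (H ≃* FreeGroup (Fin 2) × K)) (hACEP : AlmostCEP H) :
    QuotientSaturated G := by
  intro V _ _ c
  obtain ⟨S, hSf, hS1, hS⟩ := hACEP
  obtain ⟨e⟩ := hiso
  let j : FreeGroup (Fin 2) →* H :=
    (e.symm : FreeGroup (Fin 2) × K →* H).comp (MonoidHom.inl _ K)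
  have hj : Function.Injective j := e.symm.injective.comp (Prod.mk_left_injective 1)
  obtain ⟨P, hPn, hPle, hPfg, hPT⟩ := exists_normal_subgroups_freeGroup
    (T := j ⁻¹' S) (hSf.preimage hj.injOn) (by simpa using hS1) V c
  let M : V → Subgroup H := fun v ↦ (P v).map j
  have hMeq : ∀ v, M v = ((P v).map (MonoidHom.inl _ K)).map (e.symm : _ →* H) := fun v ↦
    (map_map _ _ _).symm
  have hMn : ∀ v, (M v).Normal := fun v ↦ by
    rw [hMeq]
    exact (hPn v).map_inl.map _ e.symm.surjective
  have hMS : ∀ v, Disjoint (M v : Set H) S := fun v ↦ by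
    rw [Set.disjoint_left]
    rintro _ ⟨f, hf, rfl⟩ hfS
    exact Set.disjoint_left.1 (hPT v) hf hfS
  let N : V → Subgroup G := fun v ↦ normalClosure (Subtype.val '' (M v : Set H))
  have hNM : ∀ v, M v = (N v).comap H.subtype := fun v ↦ by
    have := hS (M v) (by rw [normalClosure_eq_self]; exact (hMS v).inter_eq)
    rwa [normalClosure_eq_self] at this
  have hNle : ∀ u v, u ≤ v ↔ N u ≤ N v := fun u v ↦ by
    rw [hPle, ← map_le_map_iff_of_injective hj]
    refine ⟨fun h ↦ normalClosure_mono (Set.image_mono h), fun h ↦ ?_⟩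
    change M u ≤ M v
    rw [hNM, hNM]
    exact comap_mono h
  refine ⟨N, fun u v h ↦ le_antisymm ((hNle u v).2 h.le) ((hNle v u).2 h.ge), hNle,
    fun v ↦ ⟨normalClosure_normal, ?_⟩⟩
  have hn : (N v).Normal := normalClosure_normal
  rw [finitelyPresented_quotient_iff hfp, ← hPfg]
  refine (isFinitelyNormallyGenerated_normalClosure_iff hS (hMS v)).trans ?_
  rw [hMeq, isFinitelyNormallyGenerated_map_equiv_iff,
    isFinitelyNormallyGenerated_map_inl_iff (hPn v)]
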